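/- Let d be an admissible sequence and k₃ ∈ ℂ. Then for every real s > 0 the series G(s) = Σ_{m≥0} Σ_{n ≤ -(m+l₁+1)} c^{2n+m} q^{n-m/2} d_m q^{-2n-m} k₃ · Σ_{l=l₁}^{-(n+m)-1} (cα)^l q^{l/2} (q^{s(-2n-m-2l)} - q^{s(-2n-m)}) converges absolutely, and lim_{s→0⁺} s·G(s) = 0. -/

import Mathlib

open Filter Topology

noncomputable section

/-- `qc q x` is the real power `q ^ x`, viewed as a complex number. -/
def qc (q : ℝ) (x : ℝ) : ℂ := ((q ^ x : ℝ) : ℂ)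

/-- An admissible sequence: `d m = q^(m/2) (c₁ c^m + c₂ c^(-m))` for all `m ≥ l₁`. -/
def IsAdmissibleSeq (q : ℝ) (c : ℂ) (l₁ : ℤ) (d : ℕ → ℂ) : Prop :=
  ∃ c₁ c₂ : ℂ, ∀ m : ℕ, l₁ ≤ (m : ℤ) →
    d m = qc q ((m : ℝ) / 2) * (c₁ * c ^ (m : ℤ) + c₂ * c ^ (-(m : ℤ)))

/-- An admissible family on `ℤ × ℕ`, given by region asymptotics. -/
def IsAdmissibleFam (q : ℝ) (l₁ : ℤ) (a : ℤ → ℕ → ℂ) : Prop :=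
  ∃ (k₁ k₂ k₃ : ℂ) (A B : ℤ → ℂ), ∀ (n : ℤ) (m : ℕ),
    (l₁ ≤ n → a n m = k₁) ∧
    (-l₁ < n → n < l₁ → l₁ ≤ n + (m : ℤ) → a n m = A n) ∧
    (n ≤ -l₁ → l₁ ≤ n + (m : ℤ) → a n m = qc q (-(n : ℝ)) * k₂) ∧
    (n ≤ -l₁ → -l₁ < n + (m : ℤ) → n + (m : ℤ) < l₁ →
      a n m = qc q (-(n : ℝ)) * B (n + m)) ∧
    (n + (m : ℤ) ≤ -l₁ → a n m = qc q (-(2 * (n : ℝ) + (m : ℝ))) * k₃)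

/-- An `l`-stabilized family on `ℤ × ℕ` (the regions do not depend on `l`). -/
def IsStabilizedFam (q : ℝ) (c : ℂ) (l₁ : ℤ) (e : ℤ → ℕ → ℂ) : Prop :=
  ∃ (u w : ℂ) (f v : ℤ → ℂ) (N : ℤ), 2 * l₁ < N ∧ ∀ (n : ℤ) (m : ℕ),
    (l₁ ≤ n → e n m = (c ^ 2 * (q : ℂ)) ^ n * (c * qc q (1 / 2)) ^ m * u) ∧
    (-l₁ < n → n < l₁ → N ≤ (m : ℤ) → e n m = (c * qc q (1 / 2)) ^ m * f n) ∧
    (n ≤ -l₁ → -l₁ < n + (m : ℤ) → n + (m : ℤ) < l₁ → N ≤ (m : ℤ) →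
      e n m = qc q ((m : ℝ) / 2) * c ^ (-(m : ℤ)) * v (n + m)) ∧
    (n + (m : ℤ) ≤ -l₁ → e n m = (c ^ 2 * (q : ℂ)⁻¹) ^ n * (c * qc q (-(1 / 2))) ^ m * w)

lemma norm_qc {q : ℝ} (hq : 0 < q) (x : ℝ) : ‖qc q x‖ = q ^ x := by
  rw [qc, Complex.norm_real, Real.norm_of_nonneg (Real.rpow_nonneg hq.le x)]

/-- The values of an admissible sequence are uniformly of order `q^(m/2)`. -/
lemma IsAdmissibleSeq.exists_norm_le {q : ℝ} (hq : 0 < q) {c : ℂ} (hc : ‖c‖ = 1) {l₁ : ℤ}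
    {d : ℕ → ℂ} (hd : IsAdmissibleSeq q c l₁ d) :
    ∃ C : ℝ, 0 ≤ C ∧ ∀ m : ℕ, ‖d m‖ ≤ C * q ^ ((m : ℝ) / 2) := by
  obtain ⟨c₁, c₂, h⟩ := hd
  have hpos : ∀ m : ℕ, 0 < q ^ ((m : ℝ) / 2) := fun m => Real.rpow_pos_of_pos hq _
  have hterm : ∀ m : ℕ, 0 ≤ ‖d m‖ / q ^ ((m : ℝ) / 2) :=
    fun m => div_nonneg (norm_nonneg _) (hpos m).le
  have hsum := Finset.sum_nonneg fun m (_ : m ∈ Finset.range l₁.toNat) => hterm m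
  refine ⟨‖c₁‖ + ‖c₂‖ + ∑ m ∈ Finset.range l₁.toNat, ‖d m‖ / q ^ ((m : ℝ) / 2),
    by positivity, fun m => ?_⟩
  rw [← div_le_iff₀ (hpos m)]
  by_cases hm : l₁ ≤ (m : ℤ)
  · have hcomb : ‖c₁ * c ^ (m : ℤ) + c₂ * c ^ (-(m : ℤ))‖ ≤ ‖c₁‖ + ‖c₂‖ := by
      refine (norm_add_le _ _).trans_eq ?_
      simp only [norm_mul, norm_zpow, hc, one_zpow, mul_one]
    rw [h m hm, norm_mul, norm_qc hq, mul_div_cancel_left₀ _ (hpos m).ne']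
    linarith
  · have hmem : m ∈ Finset.range l₁.toNat := by
      rw [Finset.mem_range]
      omega
    have := Finset.single_le_sum (fun i _ => hterm i) hmem
    linarith [norm_nonneg c₁, norm_nonneg c₂]

/-- Mean value bound for `q^x` on a half-line. -/
lemma norm_qc_sub_qc_le {q : ℝ} (hq0 : 0 < q) (hq1 : q < 1) {x y z : ℝ} (hz : z ≤ x)
    (hxy : x ≤ y) : ‖qc q x - qc q y‖ ≤ q ^ z * ((y - x) * -Real.log q) := by
  have hlog := Real.log_neg hq0 hq1
  have hmono : q ^ x ≤ q ^ z := Real.rpow_le_rpow_of_exponent_ge hq0 hq1.le hz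
  have hle : q ^ (y - x) ≤ 1 := Real.rpow_le_one hq0.le hq1.le (sub_nonneg.2 hxy)
  have hexp : 1 - q ^ (y - x) ≤ (y - x) * -Real.log q := by
    rw [Real.rpow_def_of_pos hq0]
    linarith [Real.add_one_le_exp (Real.log q * (y - x))]
  have hsplit : q ^ x - q ^ y = q ^ x * (1 - q ^ (y - x)) := by
    rw [mul_sub, mul_one, ← Real.rpow_add hq0, add_sub_cancel]
  rw [qc, qc, ← Complex.ofReal_sub, Complex.norm_real, hsplit,
    Real.norm_of_nonneg (mul_nonneg (Real.rpow_nonneg hq0.le _) (sub_nonneg.2 hle))]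
  exact mul_le_mul hmono hexp (sub_nonneg.2 hle) (Real.rpow_nonneg hq0.le _)

/-- Bound for the inner sum, with `r = -(n + m)`. -/
lemma norm_sum_Icc_qc_sub_le {q : ℝ} (hq0 : 0 < q) (hq1 : q < 1) {b : ℂ} (hb : ‖b‖ = 1)
    {l₁ : ℤ} (hl₁ : 0 < l₁) {s : ℝ} (hs : 0 < s) (n : ℤ) (m r : ℕ)
    (hr : (r : ℤ) = -(n + m)) :
    ‖∑ l ∈ Finset.Icc l₁ (-(n + (m : ℤ)) - 1),
        b ^ l * qc q ((l : ℝ) / 2) *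
          (qc q (s * (-2 * (n : ℝ) - (m : ℝ) - 2 * (l : ℝ))) -
            qc q (s * (-2 * (n : ℝ) - (m : ℝ))))‖ ≤
      2 * -Real.log q * s * r ^ 2 * (q ^ s) ^ m := by
  have hlog := Real.log_neg hq0 hq1
  have hrR : (r : ℝ) = -((n : ℝ) + m) := by exact_mod_cast hr
  have hqs : 0 ≤ q ^ (s * m) := Real.rpow_nonneg hq0.le _
  have hterm : ∀ l ∈ Finset.Icc l₁ (-(n + (m : ℤ)) - 1),
      ‖b ^ l * qc q ((l : ℝ) / 2) *
          (qc q (s * (-2 * (n : ℝ) - (m : ℝ) - 2 * (l : ℝ))) -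
            qc q (s * (-2 * (n : ℝ) - (m : ℝ))))‖ ≤
        q ^ (s * m) * (2 * s * r * -Real.log q) := by
    intro l hl
    rw [Finset.mem_Icc] at hl
    have hl0 : (0 : ℝ) ≤ l := by exact_mod_cast (hl₁.le.trans hl.1)
    have hlr : (l : ℝ) ≤ r := by
      have : l ≤ (r : ℤ) := by omega
      exact_mod_cast this
    have hz : s * m ≤ s * (-2 * (n : ℝ) - m - 2 * l) :=
      mul_le_mul_of_nonneg_left (by linarith) hs.le
    have hxy : s * (-2 * (n : ℝ) - m - 2 * l) ≤ s * (-2 * (n : ℝ) - m) :=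
      mul_le_mul_of_nonneg_left (by linarith) hs.le
    rw [norm_mul, norm_mul, norm_zpow, hb, one_zpow, one_mul, norm_qc hq0]
    refine (mul_le_of_le_one_left (norm_nonneg _)
      (Real.rpow_le_one hq0.le hq1.le (by positivity))).trans
      ((norm_qc_sub_qc_le hq0 hq1 hz hxy).trans ?_)
    refine mul_le_mul_of_nonneg_left (mul_le_mul_of_nonneg_right ?_ (by linarith)) hqs
    nlinarith
  refine (norm_sum_le_of_le _ hterm).trans ?_
  have hcard : ((Finset.Icc l₁ (-(n + (m : ℤ)) - 1)).card : ℝ) ≤ r := by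
    rw [Int.card_Icc]
    exact_mod_cast (by omega : (-(n + (m : ℤ)) - 1 + 1 - l₁).toNat ≤ r)
  have hnonneg : 0 ≤ q ^ (s * m) * (2 * s * r * -Real.log q) :=
    mul_nonneg hqs (mul_nonneg (by positivity) (by linarith))
  rw [Finset.sum_const, nsmul_eq_mul]
  refine (mul_le_mul_of_nonneg_right hcard hnonneg).trans_eq ?_
  rw [Real.rpow_mul_natCast hq0.le]
  ring

/-- `s / (1 - q^s)` stays bounded as `s` tends to `0` from the right. -/
lemma mul_inv_one_sub_rpow_le {q : ℝ} (hq0 : 0 < q) (hq1 : q < 1) {s : ℝ} (hs : 0 < s) :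
    s * (1 - q ^ s)⁻¹ ≤ q ^ (-s) * (-Real.log q)⁻¹ := by
  have hlog := Real.log_neg hq0 hq1
  have hlt : q ^ s < 1 := Real.rpow_lt_one hq0.le hq1 hs
  have hpos : 0 < q ^ s := Real.rpow_pos_of_pos hq0 s
  have hinv : 1 + s * -Real.log q ≤ (q ^ s)⁻¹ := by
    rw [← Real.rpow_neg hq0.le, Real.rpow_def_of_pos hq0]
    linarith [Real.add_one_le_exp (Real.log q * -s)]
  rw [Real.rpow_neg hq0.le, ← div_eq_mul_inv, ← div_eq_mul_inv,
    div_le_div_iff₀ (by linarith) (by linarith), mul_sub, mul_one, inv_mul_cancel₀ hpos.ne']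
  linarith

/-- component of claim (1) with `l₁ ≤ l < -(n+m)` (so `n ≤ -(m+l₁+1)`). -/
theorem stmt4 (q : ℝ) (hq0 : 0 < q) (hq1 : q < 1) (c α : ℂ)
    (hc : ‖c‖ = 1) (hα : ‖α‖ = 1) (l₁ : ℤ) (hl₁ : 0 < l₁)
    (d : ℕ → ℂ) (hd : IsAdmissibleSeq q c l₁ d) (k₃ : ℂ)
    (T : ℝ → ℤ × ℕ → ℂ)
    (hT : ∀ (s : ℝ) (n : ℤ) (m : ℕ),
      T s (n, m) = c ^ (2 * n + (m : ℤ)) * qc q ((n : ℝ) - (m : ℝ) / 2) * d m *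
        qc q (-(2 * (n : ℝ) + (m : ℝ))) * k₃ *
        ∑ l ∈ Finset.Icc l₁ (-(n + (m : ℤ)) - 1),
          (c * α) ^ l * qc q ((l : ℝ) / 2) *
            (qc q (s * (-2 * (n : ℝ) - (m : ℝ) - 2 * (l : ℝ))) -
             qc q (s * (-2 * (n : ℝ) - (m : ℝ))))) :
    (∀ s : ℝ, 0 < s →
      Summable fun p : {p : ℤ × ℕ // p.1 ≤ -((p.2 : ℤ) + l₁ + 1)} => ‖T s p.1‖) ∧
    Tendsto (fun s : ℝ => (s : ℂ) *
        ∑' p : {p : ℤ × ℕ // p.1 ≤ -((p.2 : ℤ) + l₁ + 1)}, T s p.1)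
      (𝓝[>] (0 : ℝ)) (𝓝 0) := by
  obtain ⟨C, hC, hdC⟩ := hd.exists_norm_le hq0 hc
  have hlog := Real.log_neg hq0 hq1
  set K : ℝ := C * ‖k₃‖ * (2 * -Real.log q) with hK
  have hK0 : 0 ≤ K := mul_nonneg (by positivity) (by linarith)
  let φ : {p : ℤ × ℕ // p.1 ≤ -((p.2 : ℤ) + l₁ + 1)} → ℕ × ℕ :=
    fun p => ((-(p.1.1 + (p.1.2 : ℤ))).toNat, p.1.2)
  have hφ : ∀ p, ((φ p).1 : ℤ) = -(p.1.1 + (p.1.2 : ℤ)) := fun p =>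
    Int.toNat_of_nonneg (by have := p.2; omega)
  have hφinj : Function.Injective φ := by
    intro p p' h
    have h₂ : (φ p).2 = (φ p').2 := by rw [h]
    change p.1.2 = p'.1.2 at h₂
    have h₁ : ((φ p).1 : ℤ) = (φ p').1 := by rw [h]
    rw [hφ, hφ, h₂] at h₁
    exact Subtype.ext (Prod.ext (by omega) h₂)
  let F : ℝ → ℕ × ℕ → ℝ := fun s x => ((x.1 : ℝ) ^ 2 * q ^ x.1) * (q ^ s) ^ x.2
  have hF0 : ∀ s x, 0 ≤ F s x := fun s x => by positivity
  have hpoly : Summable fun r : ℕ => (r : ℝ) ^ 2 * q ^ r :=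
    summable_pow_mul_geometric_of_norm_lt_one 2 (by rwa [Real.norm_of_nonneg hq0.le])
  have hgeom : ∀ s : ℝ, 0 < s → Summable fun m : ℕ => (q ^ s) ^ m := fun s hs =>
    summable_geometric_of_lt_one (Real.rpow_nonneg hq0.le s) (Real.rpow_lt_one hq0.le hq1 hs)
  have hF : ∀ s : ℝ, 0 < s → Summable (F s) := fun s hs =>
    hpoly.mul_of_nonneg (hgeom s hs) (fun r => by positivity) (fun m => by positivity)
  have hFφ : ∀ s : ℝ, 0 < s → Summable fun p => K * s * F s (φ p) := fun s hs =>
    ((hF s hs).comp_injective hφinj).mul_left _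
  have hbound : ∀ s : ℝ, 0 < s → ∀ p, ‖T s (Subtype.val p)‖ ≤ K * s * F s (φ p) := by
    intro s hs p
    rcases hnm : p.1 with ⟨n, m⟩
    set r := (φ p).1 with hr
    have hrZ : (r : ℤ) = -(n + m) := by rw [hr, hφ, hnm]
    have hrR : (r : ℝ) = -((n : ℝ) + m) := by exact_mod_cast hrZ
    have hm : (φ p).2 = m := by simp only [φ, hnm]
    have hinner := norm_sum_Icc_qc_sub_le hq0 hq1 (b := c * α)
      (by rw [norm_mul, hc, hα, one_mul]) hl₁ hs n m r hrZ
    have hpow : q ^ ((n : ℝ) - m / 2) * q ^ ((m : ℝ) / 2) * q ^ (-(2 * (n : ℝ) + m)) = q ^ r := by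
      rw [← Real.rpow_add hq0, ← Real.rpow_add hq0, ← Real.rpow_natCast, hrR]
      congr 1
      ring
    rw [hT, norm_mul, norm_mul, norm_mul, norm_mul, norm_mul, norm_zpow, hc, one_zpow, one_mul,
      norm_qc hq0, norm_qc hq0]
    calc _ ≤ q ^ ((n : ℝ) - m / 2) * (C * q ^ ((m : ℝ) / 2)) * q ^ (-(2 * (n : ℝ) + m)) * ‖k₃‖ *
          (2 * -Real.log q * s * r ^ 2 * (q ^ s) ^ m) := by
          gcongr
          exact hdC m
      _ = C * ‖k₃‖ * (2 * -Real.log q) * s * (r ^ 2 *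
          (q ^ ((n : ℝ) - m / 2) * q ^ ((m : ℝ) / 2) * q ^ (-(2 * (n : ℝ) + m))) *
          (q ^ s) ^ m) := by ring
      _ = K * s * F s (φ p) := by rw [hpow, ← hm]
  have hsum : ∀ s : ℝ, 0 < s →
      Summable fun p : {p : ℤ × ℕ // p.1 ≤ -((p.2 : ℤ) + l₁ + 1)} => ‖T s p.1‖ :=
    fun s hs => (hFφ s hs).of_nonneg_of_le (fun _ => norm_nonneg _) (hbound s hs)
  refine ⟨hsum, ?_⟩
  set S : ℝ := ∑' r : ℕ, (r : ℝ) ^ 2 * q ^ r with hS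
  have hS0 : 0 ≤ S := tsum_nonneg fun r => by positivity
  have htsum : ∀ s : ℝ, 0 < s → ∑' x, F s x = S * (1 - q ^ s)⁻¹ := by
    intro s hs
    rw [hS, ← tsum_geometric_of_lt_one (Real.rpow_nonneg hq0.le s)
      (Real.rpow_lt_one hq0.le hq1 hs)]
    exact (hpoly.tsum_mul_tsum (hgeom s hs) (hF s hs)).symm
  refine squeeze_zero_norm' (a := fun s => s * (K * S * (q ^ (-s) * (-Real.log q)⁻¹))) ?_ ?_
  · filter_upwards [self_mem_nhdsWithin] with s hs
    have hs : 0 < s := hs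
    rw [norm_mul, Complex.norm_real, Real.norm_of_nonneg hs.le]
    refine mul_le_mul_of_nonneg_left ?_ hs.le
    calc ‖∑' p : {p : ℤ × ℕ // p.1 ≤ -((p.2 : ℤ) + l₁ + 1)}, T s p.1‖
        ≤ ∑' p, K * s * F s (φ p) := tsum_of_norm_bounded (hFφ s hs).hasSum (hbound s hs)
      _ = K * s * ∑' p, F s (φ p) := tsum_mul_left
      _ ≤ K * s * ∑' x, F s x :=
          mul_le_mul_of_nonneg_left (tsum_comp_le_tsum_of_inj (hF s hs) (hF0 s) hφinj)
            (by positivity)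
      _ = K * S * (s * (1 - q ^ s)⁻¹) := by rw [htsum s hs]; ring
      _ ≤ K * S * (q ^ (-s) * (-Real.log q)⁻¹) :=
          mul_le_mul_of_nonneg_left (mul_inv_one_sub_rpow_le hq0 hq1 hs) (by positivity)
  · have hcont : Continuous fun s : ℝ => s * (K * S * (q ^ (-s) * (-Real.log q)⁻¹)) := by
      have : Continuous fun s : ℝ => q ^ (-s) :=
        continuous_const.rpow continuous_neg fun _ => Or.inl hq0.ne'
      fun_prop
    simpa using (hcont.tendsto 0).mono_left nhdsWithin_le_nhds
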